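/- arXiv:math/0002177 — 4 statements merged into one kernel-verified Lean document; each statement's English description precedes it below -/
import Mathlib

section
/- Let A be a commutative algebra over a field k of characteristic zero and P A its Poisson envelope with grading P A = ⊕_{n≥0} P_n A induced from the grading of the free Lie algebra. Then P_1 A is isomorphic as an A-module to the module Ω²_A of Kähler 2-forms, and under this isomorphism the Poisson bracket {a, b} of two elements a, b ∈ A = P_0 A corresponds to da ∧ db. -/
/-- A Poisson bracket on a commutative `k`-algebra `P`: a bilinear Lie bracket
satisfying the Leibniz rule `{a, bc} = {a,b}c + b{a,c}`. -/
structure PoissonStructure (k : Type) [Field k]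
    (P : Type) [CommRing P] [Algebra k P] : Type where
  bracket : P →ₗ[k] P →ₗ[k] P
  bracket_self : ∀ a : P, bracket a a = 0
  jacobi : ∀ a b c : P,
    bracket a (bracket b c) = bracket (bracket a b) c + bracket b (bracket a c)
  leibniz : ∀ a b c : P, bracket a (b * c) = bracket a b * c + b * bracket a c

variable (k : Type) [Field k] [CharZero k]
variable (P : Type) [CommRing P] [Algebra k P]

/-- The ideal (as a `k`-submodule) generated by a set in the commutative ring `P`. -/
def pIdealGen (S : Set P) : Submodule k P :=
  Submodule.span k {x | ∃ a s, s ∈ S ∧ x = a * s}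

/-- The ideal generated by the Poisson brackets of elements of two submodules. -/
def pBrIdeal (pb : PoissonStructure k P) (M N : Submodule k P) : Submodule k P :=
  pIdealGen k P {x | ∃ m ∈ M, ∃ n ∈ N, x = pb.bracket m n}

/-- The Poisson commutator filtration:
`F 0 = P`, `F (n+1) = Σ_{i=1}^n F i * F (n+1-i) + Σ_{i=0}^n ⟨{F i, F (n-i)}⟩`. -/
def poissonFilt (pb : PoissonStructure k P) : ℕ → Submodule k P
  | 0 => ⊤
  | n + 1 =>
      ((Finset.Icc 1 n).attach.sum fun p =>
          poissonFilt pb p.1 * poissonFilt pb (n + 1 - p.1)) +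
      ((Finset.range (n + 1)).attach.sum fun p =>
          pBrIdeal k P pb (poissonFilt pb p.1) (poissonFilt pb (n - p.1)))
  decreasing_by
  · have := Finset.mem_Icc.mp p.2; omega
  · have := Finset.mem_Icc.mp p.2; omega
  · have := Finset.mem_range.mp p.2; omega
  · have := Finset.mem_range.mp p.2; omega

variable (A : Type) [CommRing A] [Algebra k A]

/-- The wedge `da ∧ db` as an element of `Ω²_A = ⋀[A]² Ω¹_{A/k}`. -/
noncomputable def dWedge (a b : A) : ↥(⋀[A]^2 (Ω[A⁄k])) :=
  ⟨ExteriorAlgebra.ιMulti A 2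
      ![KaehlerDifferential.D k A a, KaehlerDifferential.D k A b],
    ExteriorAlgebra.ιMulti_range A 2 (Set.mem_range_self _)⟩

theorem dWedge_coe (a b : A) : (dWedge k A a b : ExteriorAlgebra A (Ω[A⁄k])) =
    ExteriorAlgebra.ι A (KaehlerDifferential.D k A a) *
      ExteriorAlgebra.ι A (KaehlerDifferential.D k A b) := by
  simp [dWedge, ExteriorAlgebra.ιMulti_apply]

/-- `dWedge` as a `k`-bilinear map. -/
noncomputable def dWedgeBil : A →ₗ[k] A →ₗ[k] ↥(⋀[A]^2 (Ω[A⁄k])) :=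
  LinearMap.mk₂ k (dWedge k A)
    (fun a b c => Subtype.ext (by simp [dWedge_coe, add_mul]))
    (fun r a b => Subtype.ext (by
      simp only [dWedge_coe, Submodule.coe_smul_of_tower, Derivation.map_smul]
      rw [← algebraMap_smul A r, map_smul, algebraMap_smul, smul_mul_assoc]))
    (fun a b c => Subtype.ext (by simp [dWedge_coe, mul_add]))
    (fun r a b => Subtype.ext (by
      simp only [dWedge_coe, Submodule.coe_smul_of_tower, Derivation.map_smul]
      rw [← algebraMap_smul A r (KaehlerDifferential.D k A b), map_smul, algebraMap_smul,
        mul_smul_comm]))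

theorem dWedge_self (a : A) : dWedge k A a a = 0 :=
  Subtype.ext (by simp [dWedge_coe])

theorem dWedge_leibniz (a b c : A) :
    dWedge k A a (b * c) = c • dWedge k A a b + b • dWedge k A a c :=
  Subtype.ext (by simp [dWedge_coe, mul_add, add_comm])

/-- The Poisson structure on the square zero extension. -/
noncomputable def sqzPoisson (M : Type) [AddCommGroup M] [Module A M] [Module k M]
    [IsScalarTower k A M] [Module Aᵐᵒᵖ M] [IsCentralScalar A M] [IsScalarTower k Aᵐᵒᵖ M]
    (β : A →ₗ[k] A →ₗ[k] M) (h1 : ∀ a, β a a = 0)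
    (h2 : ∀ a b c, β a (b * c) = c • β a b + b • β a c) :
    PoissonStructure k (TrivSqZeroExt A M) where
  bracket := LinearMap.mk₂ k (fun x y => TrivSqZeroExt.inr (β x.fst y.fst))
    (by intros; simp) (by intros; simp) (by intros; simp) (by intros; simp)
  bracket_self a := by simp [h1]
  jacobi a b c := by simp
  leibniz a b c := by
    ext
    · simp
    · simp [h2]

theorem exists_lift (M : Type) [AddCommGroup M] [Module A M] [Module k M]
    [IsScalarTower k A M] (β : A →ₗ[k] A →ₗ[k] M) (h1 : ∀ a, β a a = 0)
    (h2 : ∀ a b c, β a (b * c) = c • β a b + b • β a c) :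
    ∃ ψ : ↥(⋀[A]^2 (Ω[A⁄k])) →ₗ[A] M, ∀ a b, ψ (dWedge k A a b) = β a b := by
  have hskew : ∀ a b, β a b = - β b a := by
    intro a b
    have := h1 (a + b)
    simp only [map_add, LinearMap.add_apply, h1, zero_add, add_zero] at this
    exact eq_neg_of_add_eq_zero_right this
  let d1 : A → Derivation k A M := fun a => Derivation.mk' (β a) (fun b c => by
    rw [h2, add_comm])
  let L : A →ₗ[k] (Ω[A⁄k] →ₗ[A] M) :=
    { toFun := fun a => (d1 a).liftKaehlerDifferential
      map_add' := fun a b => by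
        apply Derivation.liftKaehlerDifferential_unique
        ext c
        simp [d1]
      map_smul' := fun r a => by
        apply Derivation.liftKaehlerDifferential_unique
        ext c
        simp [d1] }
  have hL : ∀ a b, L a (KaehlerDifferential.D k A b) = β a b := fun a b => by
    simp [L, d1]
  let d2 : Derivation k A (Ω[A⁄k] →ₗ[A] M) := Derivation.mk' L (fun a b => by
    apply Derivation.liftKaehlerDifferential_unique
    ext c
    change L (a * b) (KaehlerDifferential.D k A c) = a • L b (KaehlerDifferential.D k A c) +
      b • L a (KaehlerDifferential.D k A c)
    simp only [hL]
    rw [hskew (a * b), h2, hskew a, hskew b]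
    simp only [smul_neg, neg_add_rev])
  let B := d2.liftKaehlerDifferential
  have hB : ∀ a b, B (KaehlerDifferential.D k A a) (KaehlerDifferential.D k A b) = β a b := by
    intro a b
    simp [B, d2, hL]
  have hBf : B = - B.flip := by
    apply Derivation.liftKaehlerDifferential_unique
    refine Derivation.ext fun a => ?_
    apply Derivation.liftKaehlerDifferential_unique
    refine Derivation.ext fun b => ?_
    change B (KaehlerDifferential.D k A a) (KaehlerDifferential.D k A b) =
      - B (KaehlerDifferential.D k A b) (KaehlerDifferential.D k A a)
    rw [hB, hB]
    exact hskew a b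
  have hBs : ∀ x, B x x = 0 := by
    intro x
    have h : B x x = - B x x := by
      conv_lhs => rw [hBf]
      simp
    have h3 : (2 : k) • B x x = 0 := by
      rw [two_smul]; exact add_eq_zero_iff_eq_neg.mpr h
    exact (smul_eq_zero.mp h3).resolve_left two_ne_zero
  let f : (Ω[A⁄k]) [⋀^Fin 2]→ₗ[A] M :=
    { toFun := fun v => B (v 0) (v 1)
      map_update_add' := by
        intro _ v i x y
        fin_cases i <;> simp
      map_update_smul' := by
        intro _ v i x y
        fin_cases i <;> simp
      map_eq_zero_of_eq' := by
        intro v i j hij hne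
        have : v 0 = v 1 := by
          fin_cases i <;> fin_cases j
          · exact absurd rfl hne
          · exact hij
          · exact hij.symm
          · exact absurd rfl hne
        rw [this, hBs] }
  refine ⟨exteriorPower.alternatingMapLinearEquiv f, fun a b => ?_⟩
  have : dWedge k A a b = exteriorPower.ιMulti A 2
      ![KaehlerDifferential.D k A a, KaehlerDifferential.D k A b] := rfl
  rw [this, exteriorPower.alternatingMapLinearEquiv_apply_ιMulti]
  exact hB a b

theorem two_forms_hom_ext (M : Type) [AddCommGroup M] [Module A M] [Module k M]
    [IsScalarTower k A M] (f f' : ↥(⋀[A]^2 (Ω[A⁄k])) →ₗ[A] M)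
    (h : ∀ a b, f (dWedge k A a b) = f' (dWedge k A a b)) : f = f' := by
  have hc : ∀ x y : Ω[A⁄k], ((exteriorPower.ιMulti A 2 ![x, y] : ↥(⋀[A]^2 (Ω[A⁄k]))) :
      ExteriorAlgebra A (Ω[A⁄k])) = ExteriorAlgebra.ι A x * ExteriorAlgebra.ι A y := by
    intro x y
    simp [ExteriorAlgebra.ιMulti_apply]
  let T : Ω[A⁄k] →ₗ[A] Ω[A⁄k] →ₗ[A] ↥(⋀[A]^2 (Ω[A⁄k])) :=
    LinearMap.mk₂ A (fun x y => exteriorPower.ιMulti A 2 ![x, y])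
      (fun _ _ _ => Subtype.ext (by simp only [hc, Submodule.coe_add, map_add, add_mul]))
      (fun _ _ _ => Subtype.ext (by simp only [hc, Submodule.coe_smul, map_smul, smul_mul_assoc]))
      (fun _ _ _ => Subtype.ext (by simp only [hc, Submodule.coe_add, map_add, mul_add]))
      (fun _ _ _ => Subtype.ext (by simp only [hc, Submodule.coe_smul, map_smul, mul_smul_comm]))
  have hT : T.compr₂ f = T.compr₂ f' := by
    apply Derivation.liftKaehlerDifferential_unique
    refine Derivation.ext fun a => ?_
    apply Derivation.liftKaehlerDifferential_unique
    refine Derivation.ext fun b => ?_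
    exact h a b
  apply exteriorPower.linearMap_ext
  ext v
  have hv : v = ![v 0, v 1] := by
    funext i
    fin_cases i <;> rfl
  rw [hv]
  exact LinearMap.congr_fun (LinearMap.congr_fun hT (v 0)) (v 1)

theorem dWedge_span (ω : ↥(⋀[A]^2 (Ω[A⁄k]))) :
    ω ∈ Submodule.span A {x | ∃ a b, x = dWedge k A a b} := by
  have := two_forms_hom_ext k A
    (↥(⋀[A]^2 (Ω[A⁄k])) ⧸ Submodule.span A {x | ∃ a b, x = dWedge k A a b})
    (Submodule.mkQ _) 0 (fun a b => by
      simp only [Submodule.mkQ_apply, LinearMap.zero_apply, Submodule.Quotient.mk_eq_zero]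
      exact Submodule.subset_span ⟨a, b, rfl⟩)
  have h2 := LinearMap.congr_fun this ω
  simpa only [Submodule.mkQ_apply, LinearMap.zero_apply, Submodule.Quotient.mk_eq_zero] using h2

theorem poissonFilt_one (pb : PoissonStructure k P) :
    poissonFilt k P pb 1 = pBrIdeal k P pb ⊤ ⊤ := by
  rw [poissonFilt, Finset.sum_attach (Finset.range (0 + 1))
    (fun p => pBrIdeal k P pb (poissonFilt k P pb p) (poissonFilt k P pb (0 - p))),
    Finset.sum_attach (Finset.Icc 1 0)
    (fun p => poissonFilt k P pb p * poissonFilt k P pb (0 + 1 - p))]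
  simp [poissonFilt]

theorem poissonFilt_two (pb : PoissonStructure k P) :
    poissonFilt k P pb 2 = poissonFilt k P pb 1 * poissonFilt k P pb 1 +
      (pBrIdeal k P pb ⊤ (poissonFilt k P pb 1) + pBrIdeal k P pb (poissonFilt k P pb 1) ⊤) := by
  have h0 : poissonFilt k P pb 0 = ⊤ := by rw [poissonFilt]
  rw [poissonFilt, Finset.sum_attach (Finset.range (1 + 1))
    (fun p => pBrIdeal k P pb (poissonFilt k P pb p) (poissonFilt k P pb (1 - p))),
    Finset.sum_attach (Finset.Icc 1 1)
    (fun p => poissonFilt k P pb p * poissonFilt k P pb (1 + 1 - p)),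
    Finset.sum_range_succ, Finset.sum_range_one]
  simp [h0]

theorem mul_mem_filt_one (pb : PoissonStructure k P) (p x : P)
    (hx : x ∈ poissonFilt k P pb 1) : p * x ∈ poissonFilt k P pb 1 := by
  rw [poissonFilt_one] at hx ⊢
  unfold pBrIdeal pIdealGen at hx ⊢
  induction hx using Submodule.span_induction with
  | mem x hx =>
    obtain ⟨a, s, hs, rfl⟩ := hx
    exact Submodule.subset_span ⟨p * a, s, hs, by ring⟩
  | zero => simp
  | add x y _ _ hx hy => rw [mul_add]; exact add_mem hx hy
  | smul r x _ hx => rw [mul_smul_comm]; exact Submodule.smul_mem _ _ hx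

theorem bracket_mem_filt_one (pb : PoissonStructure k P) (x y : P) :
    pb.bracket x y ∈ poissonFilt k P pb 1 := by
  rw [poissonFilt_one]
  exact Submodule.subset_span ⟨1, _, ⟨x, trivial, y, trivial, rfl⟩, by simp⟩

theorem mul_mem_filt_two (pb : PoissonStructure k P) (x y : P)
    (hx : x ∈ poissonFilt k P pb 1) (hy : y ∈ poissonFilt k P pb 1) :
    x * y ∈ poissonFilt k P pb 2 := by
  rw [poissonFilt_two]
  exact Submodule.mem_sup_left (Submodule.mul_mem_mul hx hy)

theorem mul_bracket_mem_filt_two (pb : PoissonStructure k P) (p x y : P)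
    (hy : y ∈ poissonFilt k P pb 1) :
    p * pb.bracket x y ∈ poissonFilt k P pb 2 := by
  rw [poissonFilt_two]
  exact Submodule.mem_sup_right (Submodule.mem_sup_left
    (Submodule.subset_span ⟨p, _, ⟨x, trivial, y, hy, rfl⟩, rfl⟩))

theorem mul_bracket_mem_filt_two' (pb : PoissonStructure k P) (p x y : P)
    (hx : x ∈ poissonFilt k P pb 1) :
    p * pb.bracket x y ∈ poissonFilt k P pb 2 := by
  rw [poissonFilt_two]
  exact Submodule.mem_sup_right (Submodule.mem_sup_right
    (Submodule.subset_span ⟨p, _, ⟨x, hx, y, trivial, rfl⟩, rfl⟩))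

/-- The subalgebra `η(A) + F₁`. -/
def envSub (pb : PoissonStructure k P) (η : A →ₐ[k] P) : Subalgebra k P where
  carrier := {x | ∃ a, x - η a ∈ poissonFilt k P pb 1}
  mul_mem' := by
    rintro x y ⟨a, ha⟩ ⟨b, hb⟩
    refine ⟨a * b, ?_⟩
    have : x * y - η (a * b) = y * (x - η a) + η a * (y - η b) := by
      rw [map_mul]; ring
    rw [this]
    exact add_mem (mul_mem_filt_one k P pb _ _ ha) (mul_mem_filt_one k P pb _ _ hb)
  add_mem' := by
    rintro x y ⟨a, ha⟩ ⟨b, hb⟩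
    refine ⟨a + b, ?_⟩
    have : x + y - η (a + b) = (x - η a) + (y - η b) := by
      rw [map_add]; ring
    rw [this]
    exact add_mem ha hb
  algebraMap_mem' r := ⟨algebraMap k A r, by simp⟩

/-- A subalgebra closed under the bracket inherits a Poisson structure. -/
def subPoisson (pb : PoissonStructure k P) (S : Subalgebra k P)
    (h : ∀ x y, pb.bracket x y ∈ S) : PoissonStructure k S where
  bracket := LinearMap.mk₂ k (fun x y => ⟨pb.bracket x y, h x y⟩)
    (fun _ _ _ => Subtype.ext (by simp)) (fun _ _ _ => Subtype.ext (by simp))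
    (fun _ _ _ => Subtype.ext (by simp)) (fun _ _ _ => Subtype.ext (by simp))
  bracket_self a := Subtype.ext (pb.bracket_self a)
  jacobi a b c := Subtype.ext (pb.jacobi a b c)
  leibniz a b c := Subtype.ext (pb.leibniz a b c)

/-- for the Poisson envelope `η : A → P` of a commutative algebra `A`
(witnessed by its universal property), the degree-one component
`P₁ A = F₁ P A / F₂ P A` is isomorphic as an `A`-module to the module `Ω²_A` of
Kähler 2-forms, the class of `{η a, η b}` corresponding to `da ∧ db`. -/
theorem envelope_degree_one_eq_kaehler_two_forms
    (pb : PoissonStructure k P) (η : A →ₐ[k] P)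
    (hP : ∀ (Q : Type) [CommRing Q] [Algebra k Q] (qb : PoissonStructure k Q)
        (f : A →ₐ[k] Q),
      ∃! g : P →ₐ[k] Q,
        (∀ x y : P, g (pb.bracket x y) = qb.bracket (g x) (g y)) ∧ g.comp η = f) :
    ∃ e : (↥(poissonFilt k P pb 1) ⧸
        (Submodule.comap (poissonFilt k P pb 1).subtype (poissonFilt k P pb 2))) ≃+
          ↥(⋀[A]^2 (Ω[A⁄k])),
      (∀ (a : A) (x y : ↥(poissonFilt k P pb 1)), (y : P) = η a * (x : P) →
        e (Submodule.Quotient.mk y) = a • e (Submodule.Quotient.mk x)) ∧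
      (∀ (a b : A) (z : ↥(poissonFilt k P pb 1)),
        (z : P) = pb.bracket (η a) (η b) →
          e (Submodule.Quotient.mk z) = dWedge k A a b) := by
  have hskew : ∀ a b, pb.bracket a b = - pb.bracket b a := by
    intro a b
    have := pb.bracket_self (a + b)
    simp only [map_add, LinearMap.add_apply, pb.bracket_self, zero_add, add_zero] at this
    exact eq_neg_of_add_eq_zero_right this
  -- every element of `P` is congruent to an element of `η(A)` modulo `F₁`
  have hdec : ∀ x : P, ∃ a, x - η a ∈ poissonFilt k P pb 1 := by
    let S := envSub k P A pb η
    have hS : ∀ x y, pb.bracket x y ∈ S := fun x y =>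
      ⟨0, by simpa using bracket_mem_filt_one k P pb x y⟩
    obtain ⟨g, ⟨hg1, hg2⟩, -⟩ := hP S (subPoisson k P pb S hS)
      (η.codRestrict S (fun a => ⟨a, by simp⟩))
    obtain ⟨i, -, hi⟩ := hP P pb η
    have e1 : S.val.comp g = AlgHom.id k P := by
      rw [hi (S.val.comp g) ⟨fun x y => by
        simp only [AlgHom.comp_apply, hg1]; rfl, by
          rw [AlgHom.comp_assoc, hg2]; rfl⟩]
      exact (hi (AlgHom.id k P) ⟨fun _ _ => rfl, rfl⟩).symm
    intro x
    have e2 : (g x : P) = x := DFunLike.congr_fun e1 x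
    have := (g x).2
    rw [e2] at this
    exact this
  -- the map to the square zero extension
  letI : Module Aᵐᵒᵖ ↥(⋀[A]^2 (Ω[A⁄k])) :=
    Module.compHom _ ((RingHom.id A).fromOpposite mul_comm)
  haveI : IsCentralScalar A ↥(⋀[A]^2 (Ω[A⁄k])) := ⟨fun _ _ => rfl⟩
  haveI : IsScalarTower k Aᵐᵒᵖ ↥(⋀[A]^2 (Ω[A⁄k])) := ⟨fun r a x => by
    change (r • a).unop • x = r • (a.unop • x)
    rw [MulOpposite.unop_smul, smul_assoc]⟩
  obtain ⟨g, ⟨hg1, hg2⟩, -⟩ := hP (TrivSqZeroExt A ↥(⋀[A]^2 (Ω[A⁄k])))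
    (sqzPoisson k A _ (dWedgeBil k A) (dWedge_self k A) (dWedge_leibniz k A))
    (TrivSqZeroExt.inlAlgHom k A _)
  have hgη : ∀ a, g (η a) = TrivSqZeroExt.inl a := fun a => DFunLike.congr_fun hg2 a
  have hgb : ∀ x y, g (pb.bracket x y) = TrivSqZeroExt.inr (dWedge k A (g x).fst (g y).fst) :=
    hg1
  have hfst : ∀ x ∈ poissonFilt k P pb 1, (g x).fst = 0 := by
    intro x hx
    rw [poissonFilt_one] at hx
    unfold pBrIdeal pIdealGen at hx
    induction hx using Submodule.span_induction with
    | mem x hx =>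
      obtain ⟨a, s, ⟨m, -, n, -, rfl⟩, rfl⟩ := hx
      simp [hgb]
    | zero => simp
    | add x y _ _ hx hy => simp [hx, hy]
    | smul r x _ hx => simp [hx]
  have hd0l : ∀ b, dWedge k A 0 b = 0 := fun b => by
    change dWedgeBil k A 0 b = 0
    simp
  have hd0r : ∀ b, dWedge k A b 0 = 0 := fun b => by
    change dWedgeBil k A b 0 = 0
    simp
  have hF2 : ∀ x ∈ poissonFilt k P pb 2, g x = 0 := by
    have : poissonFilt k P pb 2 ≤ LinearMap.ker g.toLinearMap := by
      rw [poissonFilt_two]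
      refine sup_le ?_ (sup_le ?_ ?_)
      · rw [Submodule.mul_le]
        intro m hm n hn
        have h1 := hfst m hm
        have h2 := hfst n hn
        change g (m * n) = 0
        rw [map_mul]
        ext
        · simp [h1]
        · simp [h1, h2]
      · unfold pBrIdeal pIdealGen
        rw [Submodule.span_le]
        rintro _ ⟨a, s, ⟨m, -, n, hn, rfl⟩, rfl⟩
        change g (a * _) = 0
        rw [map_mul, hgb, hfst n hn, hd0r]
        simp
      · unfold pBrIdeal pIdealGen
        rw [Submodule.span_le]
        rintro _ ⟨a, s, ⟨m, hm, n, -, rfl⟩, rfl⟩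
        change g (a * _) = 0
        rw [map_mul, hgb, hfst m hm, hd0l]
        simp
    exact this
  -- the map from two-forms to `P`
  letI : Algebra A P := η.toRingHom.toAlgebra
  have hsm : ∀ (a : A) (x : P), a • x = η a * x := fun a x => Algebra.smul_def a x
  haveI : IsScalarTower k A P := ⟨fun r a x => by
    rw [hsm, hsm, map_smul, smul_mul_assoc]⟩
  obtain ⟨ψ, hψ⟩ := exists_lift k A P
    (pb.bracket.compl₁₂ η.toLinearMap η.toLinearMap)
    (fun a => pb.bracket_self _) (fun a b c => by
      simp only [LinearMap.compl₁₂_apply, AlgHom.toLinearMap_apply, map_mul, pb.leibniz, hsm]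
      ring)
  have hψ' : ∀ a b, ψ (dWedge k A a b) = pb.bracket (η a) (η b) := hψ
  have hψF : ∀ ω, ψ ω ∈ poissonFilt k P pb 1 := by
    intro ω
    induction dWedge_span k A ω using Submodule.span_induction with
    | mem x hx =>
      obtain ⟨a, b, rfl⟩ := hx
      rw [hψ']
      exact bracket_mem_filt_one k P pb _ _
    | zero => simp
    | add x y _ _ hx hy => rw [map_add]; exact add_mem hx hy
    | smul r x _ hx => rw [map_smul, hsm]; exact mul_mem_filt_one k P pb _ _ hx
  have hgψ : ∀ ω, (g (ψ ω)).snd = ω := by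
    intro ω
    induction dWedge_span k A ω using Submodule.span_induction with
    | mem x hx =>
      obtain ⟨a, b, rfl⟩ := hx
      rw [hψ', hgb, hgη, hgη]
      simp
    | zero => simp
    | add x y _ _ hx hy => rw [map_add, map_add, TrivSqZeroExt.snd_add, hx, hy]
    | smul r x _ hx =>
      rw [map_smul, hsm, map_mul, hgη, TrivSqZeroExt.snd_mul, hx]
      simp
  have hdec2 : ∀ x ∈ poissonFilt k P pb 1, ∃ ω, x - ψ ω ∈ poissonFilt k P pb 2 := by
    intro x hx
    rw [poissonFilt_one] at hx
    unfold pBrIdeal pIdealGen at hx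
    induction hx using Submodule.span_induction with
    | mem x hx =>
      obtain ⟨p, s, ⟨u, -, v, -, rfl⟩, rfl⟩ := hx
      obtain ⟨a, ha⟩ := hdec u
      obtain ⟨b, hb⟩ := hdec v
      obtain ⟨c, hc⟩ := hdec p
      refine ⟨c • dWedge k A a b, ?_⟩
      have : p * pb.bracket u v - ψ (c • dWedge k A a b) =
          p * pb.bracket (u - η a) v + p * pb.bracket (η a) (v - η b) +
            (p - η c) * pb.bracket (η a) (η b) := by
        rw [map_smul, hsm, hψ', map_sub, map_sub, LinearMap.sub_apply]
        ring
      rw [this]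
      exact add_mem (add_mem (mul_bracket_mem_filt_two' k P pb _ _ _ ha)
        (mul_bracket_mem_filt_two k P pb _ _ _ hb))
        (mul_mem_filt_two k P pb _ _ hc (bracket_mem_filt_one k P pb _ _))
    | zero => exact ⟨0, by simp⟩
    | add x y _ _ hx hy =>
      obtain ⟨ω, h1⟩ := hx
      obtain ⟨τ, h2⟩ := hy
      refine ⟨ω + τ, ?_⟩
      rw [map_add, add_sub_add_comm]
      exact add_mem h1 h2
    | smul r x _ hx =>
      obtain ⟨ω, h1⟩ := hx
      refine ⟨algebraMap k A r • ω, ?_⟩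
      rw [map_smul, algebraMap_smul, ← smul_sub]
      exact Submodule.smul_mem _ _ h1
  -- the isomorphism
  let φ : ↥(poissonFilt k P pb 1) →ₗ[k] ↥(⋀[A]^2 (Ω[A⁄k])) :=
    { toFun := fun x => (g x).snd
      map_add' := fun x y => by simp
      map_smul' := fun r x => by simp }
  have hφ : ∀ x, φ x = (g x).snd := fun _ => rfl
  have hker : Submodule.comap (poissonFilt k P pb 1).subtype (poissonFilt k P pb 2) =
      LinearMap.ker φ := by
    ext x
    rw [Submodule.mem_comap, LinearMap.mem_ker, hφ]
    refine ⟨fun h => ?_, fun h => ?_⟩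
    · have := hF2 _ h
      change (g (x : P)) = 0 at this
      rw [this]; rfl
    · obtain ⟨ω, hω⟩ := hdec2 x x.2
      have h3 := hF2 _ hω
      have h4 : ω = 0 := by
        rw [map_sub, sub_eq_zero] at h3
        rw [← hgψ ω, ← h3, h]
      rw [h4, map_zero, sub_zero] at hω
      exact hω
  have hsurj : Function.Surjective φ := fun ω => ⟨⟨ψ ω, hψF ω⟩, hgψ ω⟩
  let e := (Submodule.quotEquivOfEq _ _ hker).trans (φ.quotKerEquivOfSurjective hsurj)
  have he : ∀ x, e (Submodule.Quotient.mk x) = (g (x : P)).snd := fun x => rfl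
  refine ⟨e.toAddEquiv, ?_, ?_⟩
  · intro a x y hxy
    change e _ = a • e _
    rw [he, he, hxy, map_mul, hgη, TrivSqZeroExt.snd_mul]
    simp
  · intro a b z hz
    change e _ = _
    rw [he, hz, hgb, hgη, hgη]
    simp
end

section
/- Let g be a Lie algebra over a field k of characteristic zero, S g its symmetric algebra, U g its universal enveloping algebra, and e : S g → U g the symmetrization map e(g_1 ⋯ g_n) = (1/n!) Σ_{σ ∈ S_n} g_{σ(1)} ⋯ g_{σ(n)}. Define B : S g ⊗ S g → S g by B(x ⊗ y) = e^{-1}(e(x) e(y)), and let B_p be the component with B_p(S^n g ⊗ S^m g) ⊆ S^{n+m-p} g. Then B_0(x ⊗ y) = x y (the symmetric algebra product) and B_1(x ⊗ y) = (1/2){x, y}, where {,} is the Poisson bracket on S g induced by the Lie bracket. -/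
open UniversalEnvelopingAlgebra

section Helpers

variable {k : Type} [Field k] {g : Type} [LieRing g] [LieAlgebra k g]
  {S : Type} [CommRing S] [Algebra k S]

theorem PoissonStructure.skew (pb : PoissonStructure k S) (a b : S) :
    pb.bracket a b = - pb.bracket b a := by
  have h := pb.bracket_self (a + b)
  simp only [map_add, LinearMap.add_apply, pb.bracket_self, zero_add, add_zero] at h
  exact eq_neg_of_add_eq_zero_right h

theorem PoissonStructure.one_right (pb : PoissonStructure k S) (a : S) :
    pb.bracket a 1 = 0 := by
  have h := pb.leibniz a 1 1
  simpa using h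

theorem PoissonStructure.leibniz_left (pb : PoissonStructure k S) (a b c : S) :
    pb.bracket (a * b) c = a * pb.bracket b c + pb.bracket a c * b := by
  rw [pb.skew (a * b) c, pb.leibniz, pb.skew a c, pb.skew b c]
  ring

/-- The sum over pairs `i < j` of `{a_i, a_j}` times the remaining factors. -/
def pairSum (pb : PoissonStructure k S) (ι : g →ₗ[k] S) : List g → S
  | [] => 0
  | a :: l => pb.bracket (ι a) (l.map ι).prod + ι a * pairSum pb ι l

theorem pairSum_append (pb : PoissonStructure k S) (ι : g →ₗ[k] S) (l₁ l₂ : List g) :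
    pairSum pb ι (l₁ ++ l₂) = pairSum pb ι l₁ * (l₂.map ι).prod
      + (l₁.map ι).prod * pairSum pb ι l₂
      + pb.bracket (l₁.map ι).prod (l₂.map ι).prod := by
  induction l₁ with
  | nil =>
    have : pb.bracket 1 (l₂.map ι).prod = 0 := by rw [pb.skew, pb.one_right, neg_zero]
    simp [pairSum, this]
  | cons a l ih =>
    simp only [List.cons_append, pairSum, ih, List.map_append, List.map_cons, List.prod_append,
      List.prod_cons, pb.leibniz, pb.leibniz_left]
    ring

theorem pairSum_reverse (pb : PoissonStructure k S) (ι : g →ₗ[k] S) (l : List g) :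
    pairSum pb ι l.reverse = - pairSum pb ι l := by
  induction l with
  | nil => simp [pairSum]
  | cons a l ih =>
    have hr : (l.reverse.map ι).prod = (l.map ι).prod :=
      ((List.reverse_perm l).map ι).prod_eq
    rw [List.reverse_cons, pairSum_append, ih, hr]
    simp only [pairSum, List.map_cons, List.map_nil, List.prod_cons, List.prod_nil, mul_one,
      pb.one_right]
    rw [pb.skew _ (ι a)]
    ring

theorem pairSum_swap (pb : PoissonStructure k S) (ι : g →ₗ[k] S)
    (hbr : ∀ x y : g, pb.bracket (ι x) (ι y) = ι ⁅x, y⁆) (u v : List g) (a b : g) :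
    pairSum pb ι (u ++ a :: b :: v) - pairSum pb ι (u ++ b :: a :: v)
      = 2 * ((u ++ ⁅a, b⁆ :: v).map ι).prod := by
  simp only [pairSum_append, pairSum, List.map_append, List.map_cons, List.prod_append,
    List.prod_cons, pb.leibniz]
  have h2 := pb.skew (ι b) (ι a)
  rw [← hbr, h2]
  ring

/-- The permuted list. -/
def permList (l : List g) (σ : Equiv.Perm (Fin l.length)) : List g :=
  List.ofFn fun i => l.get (σ i)

theorem permList_perm (l : List g) (σ : Equiv.Perm (Fin l.length)) :
    (permList l σ).Perm l := by
  have h := Equiv.Perm.ofFn_comp_perm σ l.get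
  rw [List.ofFn_get] at h
  exact h

theorem sum_pairSum [CharZero k] (pb : PoissonStructure k S) (ι : g →ₗ[k] S) (l : List g) :
    ∑ σ : Equiv.Perm (Fin l.length), pairSum pb ι (permList l σ) = 0 := by
  have h : ∑ σ : Equiv.Perm (Fin l.length), pairSum pb ι (permList l σ)
      = - ∑ σ : Equiv.Perm (Fin l.length), pairSum pb ι (permList l σ) := by
    rw [← Finset.sum_neg_distrib]
    refine Fintype.sum_equiv (Equiv.mulRight (Fin.revPerm)) _ _ fun σ => ?_
    rw [← pairSum_reverse]
    congr 1
    apply List.ext_getElem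
    · simp [permList]
    · intro i h1 h2
      simp [permList, Fin.rev]
      congr 2
      simp [permList] at h1
      congr 1
      ext
      simp
      omega
  have h2 : (2 : k) • ∑ σ : Equiv.Perm (Fin l.length), pairSum pb ι (permList l σ) = 0 := by
    rw [two_smul]
    nth_rewrite 1 [h]
    exact neg_add_cancel _
  exact (smul_eq_zero.mp h2).resolve_left two_ne_zero

/-- The word in the enveloping algebra. -/
noncomputable def uword (k : Type) [Field k] {g : Type} [LieRing g] [LieAlgebra k g]
    (l : List g) : UniversalEnvelopingAlgebra k g :=
  (l.map (UniversalEnvelopingAlgebra.ι k)).prod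

theorem uword_append (u v : List g) : uword k (u ++ v) = uword k u * uword k v := by
  simp [uword]

theorem uword_swap (u v : List g) (a b : g) :
    uword k (u ++ a :: b :: v) - uword k (u ++ b :: a :: v) = uword k (u ++ ⁅a, b⁆ :: v) := by
  simp only [uword, List.map_append, List.map_cons, List.prod_append, List.prod_cons,
    LieHom.map_lie, LieRing.of_associative_ring_bracket]
  noncomm_ring

theorem perm_diff_mem {U : Type} [AddCommGroup U] [Module k U] (N : Submodule k U)
    (f : List g → U) (n : ℕ)
    (hs : ∀ u v a b, u.length + v.length + 2 = n →
      f (u ++ a :: b :: v) - f (u ++ b :: a :: v) ∈ N)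
    {l l' : List g} (h : l.Perm l') :
    ∀ u : List g, u.length + l.length = n → f (u ++ l) - f (u ++ l') ∈ N := by
  induction h with
  | nil => intro u _; simp
  | cons a h ih =>
    intro u hu
    have := ih (u ++ [a]) (by simp at hu ⊢; omega)
    simpa using this
  | swap a b l => intro u hu; exact hs _ _ _ _ (by simp at hu; omega)
  | trans h1 h2 ih1 ih2 =>
    intro u hu
    have := N.add_mem (ih1 u hu) (ih2 u (by rw [← h1.length_eq]; exact hu))
    simpa using this

theorem avg_mem [CharZero k] {U : Type} [AddCommGroup U] [Module k U] (N : Submodule k U)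
    (f : List g → U) (l : List g)
    (hs : ∀ u v a b, u.length + v.length + 2 = l.length →
      f (u ++ a :: b :: v) - f (u ++ b :: a :: v) ∈ N) (c : U)
    (hc : ∑ σ : Equiv.Perm (Fin l.length), f (permList l σ) = (l.length.factorial : k) • c) :
    f l - c ∈ N := by
  have h0 : (l.length.factorial : k) ≠ 0 := by exact_mod_cast Nat.factorial_ne_zero _
  rw [← N.smul_mem_iff h0, smul_sub, ← hc]
  have : (l.length.factorial : k) • f l
      = ∑ σ : Equiv.Perm (Fin l.length), f l := by
    simp [Fintype.card_perm, Nat.cast_smul_eq_nsmul]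
  rw [this, ← Finset.sum_sub_distrib]
  refine N.sum_mem fun σ _ => ?_
  exact perm_diff_mem N f l.length hs (permList_perm l σ).symm [] (by simp)

/-- Image of the part of degree at most `d - 2`. -/
def lowPart (ι : g →ₗ[k] S) (d : ℕ) : Submodule k S :=
  ⨆ (j : ℕ) (_ : j + 2 ≤ d), (LinearMap.range ι) ^ j

theorem prod_mem_pow (ι : g →ₗ[k] S) (l : List g) :
    (l.map ι).prod ∈ (LinearMap.range ι) ^ l.length := by
  induction l with
  | nil => simpa using ⟨1, map_one (algebraMap k S)⟩
  | cons a l ih =>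
    rw [List.map_cons, List.prod_cons, List.length_cons, pow_succ']
    exact Submodule.mul_mem_mul ⟨a, rfl⟩ ih

theorem pow_le_span (ι : g →ₗ[k] S) (n : ℕ) :
    (LinearMap.range ι) ^ n ≤
      Submodule.span k {x | ∃ l : List g, l.length = n ∧ (l.map ι).prod = x} := by
  induction n with
  | zero =>
    rw [pow_zero, Submodule.one_eq_span]
    exact Submodule.span_mono (by rintro _ rfl; exact ⟨[], rfl, rfl⟩)
  | succ n ih =>
    rw [pow_succ', Submodule.mul_le]
    rintro _ ⟨a, rfl⟩ y hy
    replace hy := ih hy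
    induction hy using Submodule.span_induction with
    | mem y hy =>
      obtain ⟨l, hl, rfl⟩ := hy
      exact Submodule.subset_span ⟨a :: l, by simp [hl], by simp⟩
    | zero => simp
    | add y z _ _ h1 h2 => rw [mul_add]; exact Submodule.add_mem _ h1 h2
    | smul c y _ h => rw [mul_smul_comm]; exact Submodule.smul_mem _ _ h

theorem lowPart_mono (ι : g →ₗ[k] S) {d d' : ℕ} (h : d ≤ d') : lowPart ι d ≤ lowPart ι d' := by
  refine iSup₂_le fun j hj => ?_
  exact le_iSup₂_of_le (f := fun (j : ℕ) (_ : j + 2 ≤ d') => (LinearMap.range ι) ^ j)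
    j (hj.trans h) le_rfl

theorem pow_le_lowPart (ι : g →ₗ[k] S) (n : ℕ) : (LinearMap.range ι) ^ n ≤ lowPart ι (n + 2) :=
  le_iSup₂_of_le (f := fun (j : ℕ) (_ : j + 2 ≤ n + 2) => (LinearMap.range ι) ^ j) n le_rfl le_rfl

theorem first_order [CharZero k] (ι : g →ₗ[k] S)
    (e : S ≃ₗ[k] UniversalEnvelopingAlgebra k g)
    (he : ∀ l : List g, ∑ σ : Equiv.Perm (Fin l.length), uword k (permList l σ)
      = (l.length.factorial : k) • e ((l.map ι).prod))
    (n : ℕ) : ∀ l : List g, l.length = n →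
    uword k l - e (l.map ι).prod ∈ (lowPart ι (n + 1)).map e.toLinearMap := by
  induction n with
  | zero =>
    intro l hl
    refine avg_mem _ (uword k) l (fun u v a b h => by omega) _ (he l)
  | succ n ih =>
    intro l hl
    refine avg_mem _ (uword k) l (fun u v a b h => ?_) _ (he l)
    rw [uword_swap]
    have hlen : (u ++ ⁅a, b⁆ :: v).length = n := by simp; omega
    have h1 := ih _ hlen
    have h2 : e ((u ++ ⁅a, b⁆ :: v).map ι).prod ∈ (lowPart ι (n + 1 + 1)).map e.toLinearMap :=
      Submodule.mem_map_of_mem (pow_le_lowPart ι n (hlen ▸ prod_mem_pow ι _))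
    have h3 := Submodule.add_mem _
      (Submodule.map_mono (lowPart_mono ι (Nat.le_succ (n + 1))) h1) h2
    simpa using h3

theorem second_order [CharZero k] (pb : PoissonStructure k S) (ι : g →ₗ[k] S)
    (hbr : ∀ x y : g, pb.bracket (ι x) (ι y) = ι ⁅x, y⁆)
    (e : S ≃ₗ[k] UniversalEnvelopingAlgebra k g)
    (he : ∀ l : List g, ∑ σ : Equiv.Perm (Fin l.length), uword k (permList l σ)
      = (l.length.factorial : k) • e ((l.map ι).prod))
    (l : List g) :
    uword k l - (2 : k)⁻¹ • e (pairSum pb ι l) - e (l.map ι).prod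
      ∈ (lowPart ι l.length).map e.toLinearMap := by
  refine avg_mem _ (fun l => uword k l - (2 : k)⁻¹ • e (pairSum pb ι l)) l
    (fun u v a b h => ?_) _ ?_
  · have hlen : (u ++ ⁅a, b⁆ :: v).length + 1 = l.length := by simp; omega
    have h1 := first_order ι e he _ (u ++ ⁅a, b⁆ :: v) rfl
    rw [hlen, ← uword_swap] at h1
    have h2 := pairSum_swap pb ι hbr u v a b
    have h3 : e ((u ++ ⁅a, b⁆ :: v).map ι).prod = (2 : k)⁻¹ •
        (e (pairSum pb ι (u ++ a :: b :: v)) - e (pairSum pb ι (u ++ b :: a :: v))) := by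
      rw [← map_sub, h2, ← map_smul, two_mul, ← two_smul k, smul_smul,
        inv_mul_cancel₀ two_ne_zero, one_smul]
    rw [h3] at h1
    convert h1 using 1
    rw [smul_sub]
    abel
  · rw [Finset.sum_sub_distrib, he, ← Finset.smul_sum, ← map_sum, sum_pairSum]
    simp

theorem list_case [CharZero k] (pb : PoissonStructure k S) (ι : g →ₗ[k] S)
    (hbr : ∀ x y : g, pb.bracket (ι x) (ι y) = ι ⁅x, y⁆)
    (e : S ≃ₗ[k] UniversalEnvelopingAlgebra k g)
    (he : ∀ l : List g, ∑ σ : Equiv.Perm (Fin l.length), uword k (permList l σ)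
      = (l.length.factorial : k) • e ((l.map ι).prod))
    (a b : List g) :
    e (a.map ι).prod * e (b.map ι).prod - e ((a.map ι).prod * (b.map ι).prod)
      - (2 : k)⁻¹ • e (pb.bracket (a.map ι).prod (b.map ι).prod)
      ∈ (lowPart ι (a.length + b.length)).map e.toLinearMap := by
  set N := (lowPart ι (a.length + b.length)).map e.toLinearMap
  set x := (a.map ι).prod with hx
  set y := (b.map ι).prod with hy
  have ha0 : (a.length.factorial : k) ≠ 0 := by exact_mod_cast Nat.factorial_ne_zero _
  have hb0 : (b.length.factorial : k) ≠ 0 := by exact_mod_cast Nat.factorial_ne_zero _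
  rw [← N.smul_mem_iff ha0, ← N.smul_mem_iff hb0]
  have key : ∀ (σ : Equiv.Perm (Fin a.length)) (τ : Equiv.Perm (Fin b.length)),
      uword k (permList a σ) * uword k (permList b τ)
        - (2 : k)⁻¹ • e (pairSum pb ι (permList a σ) * y + x * pairSum pb ι (permList b τ)
            + pb.bracket x y) - e (x * y) ∈ N := by
    intro σ τ
    have h := second_order pb ι hbr e he (permList a σ ++ permList b τ)
    have e1 : ((permList a σ).map ι).prod = x := ((permList_perm a σ).map ι).prod_eq
    have e2 : ((permList b τ).map ι).prod = y := ((permList_perm b τ).map ι).prod_eq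
    rw [uword_append, pairSum_append, List.map_append, List.prod_append, e1, e2,
      List.length_append, (permList_perm a σ).length_eq, (permList_perm b τ).length_eq] at h
    exact h
  have h := N.sum_mem (t := Finset.univ) fun σ _ =>
    N.sum_mem (t := Finset.univ) fun τ _ => key σ τ
  convert h using 1
  have s1 : ∑ σ : Equiv.Perm (Fin a.length), ∑ τ : Equiv.Perm (Fin b.length),
      uword k (permList a σ) * uword k (permList b τ)
      = (b.length.factorial : k) • (a.length.factorial : k) • (e x * e y) := by
    rw [← Finset.sum_mul_sum, he, he, smul_mul_smul_comm, smul_smul, mul_comm]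
  have s2 : ∑ σ : Equiv.Perm (Fin a.length), ∑ τ : Equiv.Perm (Fin b.length),
      (pairSum pb ι (permList a σ) * y + x * pairSum pb ι (permList b τ) + pb.bracket x y)
      = (b.length.factorial : k) • (a.length.factorial : k) • pb.bracket x y := by
    simp only [Finset.sum_add_distrib, ← Finset.mul_sum, sum_pairSum, mul_zero, Finset.sum_const,
      ← Finset.smul_sum, ← Finset.sum_mul, zero_mul, smul_zero, zero_add, Finset.card_univ,
      Fintype.card_perm, Fintype.card_fin, Nat.cast_smul_eq_nsmul]
    rw [smul_comm]
  simp only [Finset.sum_sub_distrib, s1, ← Finset.smul_sum, ← map_sum, s2]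
  simp only [Finset.sum_const, Finset.card_univ, Fintype.card_perm, Fintype.card_fin, map_smul,
    map_nsmul, ← Nat.cast_smul_eq_nsmul k]
  module

end Helpers

/-- Let `S` be the symmetric algebra of a Lie algebra `g` (witnessed by
`ι : g →ₗ S` with the universal property of the free commutative algebra), equipped
with the Poisson bracket extending the Lie bracket of `g` by the Leibniz rule, and let
`e : S ≃ U g` be the symmetrization map `e(g₁⋯gₙ) = (1/n!) Σ_σ g_{σ(1)}⋯g_{σ(n)}`.
Writing `B(x ⊗ y) = e⁻¹(e x · e y) = Σ_p B_p(x ⊗ y)` with `B_p(Sⁿ ⊗ Sᵐ) ⊆ S^{n+m-p}`,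
one has `B₀(x ⊗ y) = x y` and `B₁(x ⊗ y) = ½{x,y}`; equivalently, for `x ∈ Sⁿ`,
`y ∈ Sᵐ`, the element `B(x ⊗ y) - x y - ½{x,y}` lies in `⊕_{j ≤ n+m-2} S^j`. -/
theorem symmetrization_B0_B1
    (k : Type) [Field k] [CharZero k]
    (g : Type) [LieRing g] [LieAlgebra k g]
    (S : Type) [CommRing S] [Algebra k S]
    (pb : PoissonStructure k S) (ι : g →ₗ[k] S)
    (hfree : ∀ (C : Type) [CommRing C] [Algebra k C] (f : g →ₗ[k] C),
      ∃! h : S →ₐ[k] C, h.toLinearMap.comp ι = f)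
    (hbr : ∀ x y : g, pb.bracket (ι x) (ι y) = ι ⁅x, y⁆)
    (e : S ≃ₗ[k] UniversalEnvelopingAlgebra k g)
    (he : ∀ l : List g,
      e ((l.map ι).prod) =
        ((l.length.factorial : k)⁻¹) •
          ∑ σ : Equiv.Perm (Fin l.length),
            (List.ofFn fun i => UniversalEnvelopingAlgebra.ι k (l.get (σ i))).prod)
    (n m : ℕ) (x y : S)
    (hx : x ∈ (LinearMap.range ι) ^ n) (hy : y ∈ (LinearMap.range ι) ^ m) :
    e.symm (e x * e y) - x * y - (2 : k)⁻¹ • pb.bracket x y ∈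
      ⨆ (j : ℕ) (_ : j + 2 ≤ n + m), (LinearMap.range ι) ^ j := by
  have he' : ∀ l : List g, ∑ σ : Equiv.Perm (Fin l.length), uword k (permList l σ)
      = (l.length.factorial : k) • e ((l.map ι).prod) := by
    intro l
    have h0 : (l.length.factorial : k) ≠ 0 := by exact_mod_cast Nat.factorial_ne_zero _
    rw [he, smul_smul, mul_inv_cancel₀ h0, one_smul]
    refine Finset.sum_congr rfl fun σ _ => ?_
    simp only [uword, permList, List.map_ofFn]
    rfl
  change _ ∈ lowPart ι (n + m)
  replace hx := pow_le_span ι n hx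
  replace hy := pow_le_span ι m hy
  induction hx using Submodule.span_induction with
  | zero => simp
  | add x z _ _ h1 h2 =>
    convert Submodule.add_mem _ h1 h2 using 1
    simp only [map_add, add_mul, LinearMap.add_apply, smul_add]
    abel
  | smul c x _ h =>
    convert Submodule.smul_mem _ c h using 1
    simp only [map_smul, smul_mul_assoc, LinearMap.smul_apply, smul_sub]
    rw [smul_comm c]
  | mem x hx =>
    obtain ⟨a, rfl, rfl⟩ := hx
    induction hy using Submodule.span_induction with
    | zero => simp
    | add x z _ _ h1 h2 =>
      convert Submodule.add_mem _ h1 h2 using 1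
      simp only [map_add, mul_add, smul_add]
      abel
    | smul c x _ h =>
      convert Submodule.smul_mem _ c h using 1
      simp only [map_smul, mul_smul_comm, smul_sub]
      rw [smul_comm c]
    | mem y hy =>
      obtain ⟨b, rfl, rfl⟩ := hy
      obtain ⟨z, hz, hz'⟩ := list_case pb ι hbr e he' a b
      have : z = e.symm (e (a.map ι).prod * e (b.map ι).prod) - (a.map ι).prod * (b.map ι).prod
          - (2 : k)⁻¹ • pb.bracket (a.map ι).prod (b.map ι).prod := by
        apply e.injective
        simpa using hz'
      rw [← this]
      exact hz
end

section
/- Let V be a vector space over a field k of characteristic zero, T V the tensor algebra with commutator filtration F, and L_n V the graded pieces of the free Lie algebra (L_0 V = V, L_{n+1} V = [V, L_n V]). Then F_n T V = Σ_r Σ_{d_1 + ⋯ + d_r ≥ n} L_{d_1} V · ⋯ · L_{d_r} V. -/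
open Submodule

variable (k : Type) [Field k] [CharZero k]
variable (R : Type) [Ring R] [Algebra k R]

/-- The two-sided ideal (as a `k`-submodule) generated by a set. -/
def idealGen (S : Set R) : Submodule k R :=
  Submodule.span k {x | ∃ a s b, s ∈ S ∧ x = a * s * b}

/-- The set of commutators of elements of two submodules. -/
def brIdeal (M N : Submodule k R) : Submodule k R :=
  idealGen k R {x | ∃ m ∈ M, ∃ n ∈ N, x = m * n - n * m}

/-- The commutator filtration of `R`:
`F 0 = R`, `F (n+1) = Σ_{p=1}^n F p * F (n+1-p) + Σ_{p=0}^n ⟨[F p, F (n-p)]⟩`. -/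
def commFilt : ℕ → Submodule k R
  | 0 => ⊤
  | n + 1 =>
      ((Finset.Icc 1 n).attach.sum fun p =>
          commFilt p.1 * commFilt (n + 1 - p.1)) +
      ((Finset.range (n + 1)).attach.sum fun p =>
          brIdeal k R (commFilt p.1) (commFilt (n - p.1)))
  decreasing_by
  · have := Finset.mem_Icc.mp p.2; omega
  · have := Finset.mem_Icc.mp p.2; omega
  · have := Finset.mem_range.mp p.2; omega
  · have := Finset.mem_range.mp p.2; omega

variable (V : Type) [AddCommGroup V] [Module k V]

/-- The graded pieces of the free Lie algebra inside the tensor algebra: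
`L 0 = V`, `L (n+1) = [V, L n]` (with `[a,b] = a*b - b*a`). -/
def freeLieGrade : ℕ → Submodule k (TensorAlgebra k V)
  | 0 => LinearMap.range (TensorAlgebra.ι k (M := V))
  | n + 1 => Submodule.span k
      {z | ∃ x ∈ freeLieGrade 0, ∃ y ∈ freeLieGrade n, z = x * y - y * x}

theorem commFilt_succ (n : ℕ) : commFilt k R (n + 1) =
    (∑ p ∈ Finset.Icc 1 n, commFilt k R p * commFilt k R (n + 1 - p)) +
      ∑ p ∈ Finset.range (n + 1), brIdeal k R (commFilt k R p) (commFilt k R (n - p)) := by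
  rw [commFilt]
  congr 1
  · exact Finset.sum_attach (Finset.Icc 1 n)
      (fun p => commFilt k R p * commFilt k R (n + 1 - p))
  · exact Finset.sum_attach (Finset.range (n + 1))
      (fun p => brIdeal k R (commFilt k R p) (commFilt k R (n - p)))

theorem sum_le_of_le {ι M : Type} [AddCommGroup M] [Module k M] (s : Finset ι)
    (f : ι → Submodule k M) (N : Submodule k M) (h : ∀ i ∈ s, f i ≤ N) :
    ∑ i ∈ s, f i ≤ N := by
  classical
  induction s using Finset.induction_on with
  | empty => simp
  | insert a s ha ih =>
    rw [Finset.sum_insert ha, Submodule.add_eq_sup]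
    exact sup_le (h a (by simp)) (ih fun i hi => h i (by simp [hi]))

theorem le_sum_of_mem {ι M : Type} [AddCommGroup M] [Module k M] (s : Finset ι)
    (f : ι → Submodule k M) (i : ι) (hi : i ∈ s) : f i ≤ ∑ i ∈ s, f i := by
  classical
  rw [← Finset.add_sum_erase s f hi, Submodule.add_eq_sup]
  exact le_sup_left

theorem commFilt_succ_le (n : ℕ) (N : Submodule k R)
    (h1 : ∀ p, 1 ≤ p → p ≤ n → commFilt k R p * commFilt k R (n + 1 - p) ≤ N)
    (h2 : ∀ p, p ≤ n → brIdeal k R (commFilt k R p) (commFilt k R (n - p)) ≤ N) :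
    commFilt k R (n + 1) ≤ N := by
  rw [commFilt_succ, Submodule.add_eq_sup]
  refine sup_le (sum_le_of_le k _ _ _ fun p hp => ?_) (sum_le_of_le k _ _ _ fun p hp => ?_)
  · rw [Finset.mem_Icc] at hp
    exact h1 p hp.1 hp.2
  · rw [Finset.mem_range] at hp
    exact h2 p (by omega)

theorem commFilt_zero : commFilt k R 0 = ⊤ := by rw [commFilt]

theorem brIdeal_commFilt_le (p q : ℕ) :
    brIdeal k R (commFilt k R p) (commFilt k R q) ≤ commFilt k R (p + q + 1) := by
  rw [commFilt_succ, Submodule.add_eq_sup]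
  have := le_sum_of_mem k (Finset.range (p + q + 1))
    (fun i => brIdeal k R (commFilt k R i) (commFilt k R (p + q - i))) p
    (by rw [Finset.mem_range]; omega)
  simp only [Nat.add_sub_cancel_left] at this
  exact this.trans le_sup_right

theorem commFilt_mul_le_pos (p q : ℕ) (hp : 1 ≤ p) (hq : 1 ≤ q) :
    commFilt k R p * commFilt k R q ≤ commFilt k R (p + q) := by
  obtain ⟨q, rfl⟩ : ∃ r, q = r + 1 := ⟨q - 1, by omega⟩
  rw [← add_assoc, commFilt_succ k R (p + q), Submodule.add_eq_sup]
  have := le_sum_of_mem k (Finset.Icc 1 (p + q))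
    (fun i => commFilt k R i * commFilt k R (p + q + 1 - i)) p
    (by simp; omega)
  simp only [show p + q + 1 - p = q + 1 by omega] at this
  exact this.trans le_sup_left

theorem brIdeal_ideal (M N : Submodule k R) :
    ⊤ * brIdeal k R M N ≤ brIdeal k R M N ∧ brIdeal k R M N * ⊤ ≤ brIdeal k R M N := by
  unfold brIdeal idealGen
  constructor
  · rw [← Submodule.span_univ, Submodule.span_mul_span, Submodule.span_le]
    rintro _ ⟨c, -, _, ⟨a, s, b, hs, rfl⟩, rfl⟩
    exact Submodule.subset_span ⟨c * a, s, b, hs, by simp only [mul_assoc]⟩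
  · rw [← Submodule.span_univ, Submodule.span_mul_span, Submodule.span_le]
    rintro _ ⟨_, ⟨a, s, b, hs, rfl⟩, c, -, rfl⟩
    exact Submodule.subset_span ⟨a, s, b * c, hs, by simp only [mul_assoc]⟩

theorem commFilt_ideal (n : ℕ) :
    ⊤ * commFilt k R n ≤ commFilt k R n ∧ commFilt k R n * ⊤ ≤ commFilt k R n := by
  induction n using Nat.strong_induction_on with
  | _ n ih =>
    rcases n with _ | n
    · rw [commFilt_zero]; exact ⟨le_top, le_top⟩
    · rw [commFilt_succ, Submodule.add_eq_sup, Submodule.mul_sup, Submodule.sup_mul,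
        Finset.mul_sum, Finset.sum_mul, Finset.mul_sum, Finset.sum_mul]
      constructor
      · refine sup_le_sup (Finset.sum_le_sum fun p hp => ?_) (Finset.sum_le_sum fun p hp => ?_)
        · rw [Finset.mem_Icc] at hp
          rw [← mul_assoc]
          exact mul_le_mul_left (ih p (by omega)).1 _
        · exact (brIdeal_ideal k R _ _).1
      · refine sup_le_sup (Finset.sum_le_sum fun p hp => ?_) (Finset.sum_le_sum fun p hp => ?_)
        · rw [Finset.mem_Icc] at hp
          rw [mul_assoc]
          exact mul_le_mul_right (ih (n + 1 - p) (by omega)).2 _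
        · exact (brIdeal_ideal k R _ _).2

theorem commFilt_mul_le (p q : ℕ) :
    commFilt k R p * commFilt k R q ≤ commFilt k R (p + q) := by
  rcases Nat.eq_zero_or_pos p with rfl | hp
  · rw [commFilt_zero, zero_add]; exact (commFilt_ideal k R q).1
  rcases Nat.eq_zero_or_pos q with rfl | hq
  · rw [commFilt_zero, add_zero]; exact (commFilt_ideal k R p).2
  exact commFilt_mul_le_pos k R p q hp hq

theorem brIdeal_mono {M M' N N' : Submodule k R} (h : M ≤ M') (h' : N ≤ N') :
    brIdeal k R M N ≤ brIdeal k R M' N' := by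
  unfold brIdeal idealGen
  refine Submodule.span_mono ?_
  rintro _ ⟨a, s, b, ⟨m, hm, n, hn, rfl⟩, rfl⟩
  exact ⟨a, _, b, ⟨m, h hm, n, h' hn, rfl⟩, rfl⟩

theorem commFilt_succ_le_self (n : ℕ) : commFilt k R (n + 1) ≤ commFilt k R n := by
  induction n using Nat.strong_induction_on with
  | _ n ih =>
    rcases n with _ | n
    · rw [commFilt_zero]; exact le_top
    · refine commFilt_succ_le k R (n + 1) _ (fun p hp hpn => ?_) (fun p hp => ?_)
      · obtain ⟨p, rfl⟩ : ∃ r, p = r + 1 := ⟨p - 1, by omega⟩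
        refine (mul_le_mul_left (ih p (by omega)) _).trans ?_
        refine (commFilt_mul_le k R _ _).trans (le_of_eq ?_)
        congr 1; omega
      · rcases p with _ | p
        · refine (brIdeal_mono k R le_rfl (ih n (by omega))).trans ?_
          refine (brIdeal_commFilt_le k R _ _).trans (le_of_eq ?_)
          congr 1; omega
        · refine (brIdeal_mono k R (ih p (by omega)) le_rfl).trans ?_
          refine (brIdeal_commFilt_le k R _ _).trans (le_of_eq ?_)
          congr 1; omega

theorem commFilt_antitone : Antitone (commFilt k R) :=
  antitone_nat_of_succ_le (commFilt_succ_le_self k R)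

theorem freeLieGrade_le_commFilt (n : ℕ) :
    freeLieGrade k V n ≤ commFilt k (TensorAlgebra k V) n := by
  induction n with
  | zero => rw [commFilt_zero]; exact le_top
  | succ n ih =>
    rw [freeLieGrade, Submodule.span_le]
    rintro _ ⟨x, -, y, hy, rfl⟩
    have := brIdeal_commFilt_le k (TensorAlgebra k V) 0 n
    rw [zero_add] at this
    apply this
    refine Submodule.subset_span ⟨1, _, 1, ⟨x, ?_, y, ih hy, rfl⟩, by simp⟩
    rw [commFilt_zero]; trivial

theorem listProd_le_commFilt (l : List ℕ) :
    (l.map fun d => freeLieGrade k V d).prod ≤ commFilt k (TensorAlgebra k V) l.sum := by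
  induction l with
  | nil => rw [List.sum_nil, commFilt_zero]; exact le_top
  | cons a l ih =>
    rw [List.map_cons, List.prod_cons, List.sum_cons]
    exact (mul_le_mul' (freeLieGrade_le_commFilt k V a) ih).trans (commFilt_mul_le k _ _ _)

/-- The right-hand side of the theorem. -/
def lieFilt (n : ℕ) : Submodule k (TensorAlgebra k V) :=
  ⨆ (l : List ℕ) (_ : n ≤ l.sum), (l.map fun d => freeLieGrade k V d).prod

theorem listProd_le_lieFilt (l : List ℕ) (n : ℕ) (h : n ≤ l.sum) :
    (l.map fun d => freeLieGrade k V d).prod ≤ lieFilt k V n :=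
  le_iSup₂_of_le l h le_rfl

theorem freeLieGrade_le_lieFilt (n : ℕ) : freeLieGrade k V n ≤ lieFilt k V n := by
  have := listProd_le_lieFilt k V [n] n (by simp)
  simpa using this

theorem lieFilt_antitone {m n : ℕ} (h : m ≤ n) : lieFilt k V n ≤ lieFilt k V m :=
  iSup₂_le fun l hl => listProd_le_lieFilt k V l m (h.trans hl)

theorem lieFilt_mul_le (p q : ℕ) : lieFilt k V p * lieFilt k V q ≤ lieFilt k V (p + q) := by
  rw [lieFilt, lieFilt]
  simp only [Submodule.iSup_mul, Submodule.mul_iSup]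
  refine iSup₂_le fun l hl => iSup₂_le fun m hm => ?_
  rw [← List.prod_append, ← List.map_append]
  refine listProd_le_lieFilt k V _ _ ?_
  rw [List.sum_append]; omega

theorem lieFilt_zero : lieFilt k V 0 = ⊤ := by
  rw [eq_top_iff]
  rintro x -
  induction x using TensorAlgebra.induction with
  | algebraMap r =>
    apply listProd_le_lieFilt k V [] 0 (by simp)
    simp
  | ι x =>
    apply freeLieGrade_le_lieFilt k V 0
    rw [freeLieGrade]; exact ⟨x, rfl⟩
  | mul a b ha hb =>
    exact lieFilt_mul_le k V 0 0 (Submodule.mul_mem_mul ha hb)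
  | add a b ha hb => exact add_mem ha hb

theorem freeLieGrade_comm (a : ℕ) : ∀ (b : ℕ) (x y : TensorAlgebra k V),
    x ∈ freeLieGrade k V a → y ∈ freeLieGrade k V b →
    x * y - y * x ∈ freeLieGrade k V (a + b + 1) := by
  induction a with
  | zero =>
    intro b x y hx hy
    rw [zero_add, freeLieGrade]
    exact Submodule.subset_span ⟨x, hx, y, hy, rfl⟩
  | succ a ih =>
    intro b x y hx hy
    rw [freeLieGrade] at hx
    induction hx using Submodule.span_induction with
    | mem x hx =>
      obtain ⟨v, hv, w, hw, rfl⟩ := hx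
      have h0 : ∀ c z, z ∈ freeLieGrade k V c → v * z - z * v ∈ freeLieGrade k V (c + 1) := by
        intro c z hz
        rw [freeLieGrade]
        exact Submodule.subset_span ⟨v, hv, z, hz, rfl⟩
      have h1 := h0 _ _ (ih b w y hw hy)
      have h2 := ih (b + 1) w _ hw (h0 _ _ hy)
      rw [show a + (b + 1) + 1 = a + 1 + b + 1 by omega] at h2
      rw [show a + b + 1 + 1 = a + 1 + b + 1 by omega] at h1
      convert sub_mem h1 h2 using 1
      noncomm_ring
    | zero => simp
    | add x x' _ _ h h' =>
      convert add_mem h h' using 1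
      noncomm_ring
    | smul c x _ h =>
      convert Submodule.smul_mem _ c h using 1
      rw [smul_sub, smul_mul_assoc, mul_smul_comm]

theorem comm_step1 (a : ℕ) (x : TensorAlgebra k V) (hx : x ∈ freeLieGrade k V a) (m : List ℕ) :
    ∀ y ∈ (m.map fun d => freeLieGrade k V d).prod,
      x * y - y * x ∈ lieFilt k V (a + m.sum + 1) := by
  induction m with
  | nil =>
    intro y hy
    rw [List.map_nil, List.prod_nil, Submodule.mem_one] at hy
    obtain ⟨c, rfl⟩ := hy
    rw [Algebra.commutes, sub_self]
    exact zero_mem _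
  | cons b m ih =>
    intro y hy
    rw [List.map_cons, List.prod_cons] at hy
    rw [List.sum_cons]
    induction hy using Submodule.mul_induction_on' with
    | mem_mul_mem u hu v hv =>
      have h1 := lieFilt_mul_le k V _ _ (Submodule.mul_mem_mul
        (freeLieGrade_le_lieFilt k V _ (freeLieGrade_comm k V a b x u hx hu))
        (listProd_le_lieFilt k V m _ le_rfl hv))
      have h2 := lieFilt_mul_le k V _ _ (Submodule.mul_mem_mul
        (freeLieGrade_le_lieFilt k V _ hu) (ih v hv))
      rw [show a + b + 1 + m.sum = a + (b + m.sum) + 1 by omega] at h1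
      rw [show b + (a + m.sum + 1) = a + (b + m.sum) + 1 by omega] at h2
      convert add_mem h1 h2 using 1
      noncomm_ring
    | add y _ y' _ h h' =>
      convert add_mem h h' using 1
      noncomm_ring

theorem comm_step2 (l m : List ℕ) (y : TensorAlgebra k V)
    (hy : y ∈ (m.map fun d => freeLieGrade k V d).prod) :
    ∀ x ∈ (l.map fun d => freeLieGrade k V d).prod,
      x * y - y * x ∈ lieFilt k V (l.sum + m.sum + 1) := by
  induction l with
  | nil =>
    intro x hx
    rw [List.map_nil, List.prod_nil, Submodule.mem_one] at hx
    obtain ⟨c, rfl⟩ := hx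
    rw [Algebra.commutes, sub_self]
    exact zero_mem _
  | cons b l ih =>
    intro x hx
    rw [List.map_cons, List.prod_cons] at hx
    rw [List.sum_cons]
    induction hx using Submodule.mul_induction_on' with
    | mem_mul_mem u hu v hv =>
      have h1 := lieFilt_mul_le k V _ _ (Submodule.mul_mem_mul
        (comm_step1 k V b u hu m y hy)
        (listProd_le_lieFilt k V l _ le_rfl hv))
      have h2 := lieFilt_mul_le k V _ _ (Submodule.mul_mem_mul
        (freeLieGrade_le_lieFilt k V _ hu) (ih v hv))
      rw [show b + m.sum + 1 + l.sum = b + l.sum + m.sum + 1 by omega] at h1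
      rw [show b + (l.sum + m.sum + 1) = b + l.sum + m.sum + 1 by omega] at h2
      convert add_mem h1 h2 using 1
      noncomm_ring
    | add y _ y' _ h h' =>
      convert add_mem h h' using 1
      noncomm_ring

theorem lieFilt_comm (p q : ℕ) (x y : TensorAlgebra k V)
    (hx : x ∈ lieFilt k V p) (hy : y ∈ lieFilt k V q) :
    x * y - y * x ∈ lieFilt k V (p + q + 1) := by
  have h1 : lieFilt k V p ≤ (lieFilt k V (p + q + 1)).comap
      (LinearMap.mulRight k y - LinearMap.mulLeft k y) := by
    refine iSup₂_le fun l hl x hx => ?_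
    have h2 : lieFilt k V q ≤ (lieFilt k V (p + q + 1)).comap
        (LinearMap.mulLeft k x - LinearMap.mulRight k x) := by
      refine iSup₂_le fun m hm y hy => ?_
      have := comm_step2 k V l m y hy x hx
      exact lieFilt_antitone k V (by omega) this
    exact h2 hy
  exact h1 hx

theorem brIdeal_lieFilt_le (p q : ℕ) :
    brIdeal k (TensorAlgebra k V) (lieFilt k V p) (lieFilt k V q) ≤ lieFilt k V (p + q + 1) := by
  unfold brIdeal idealGen
  rw [Submodule.span_le]
  rintro _ ⟨a, _, b, ⟨x, hx, y, hy, rfl⟩, rfl⟩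
  have ht : ∀ c, c ∈ lieFilt k V 0 := fun c => by rw [lieFilt_zero]; trivial
  have h1 := lieFilt_mul_le k V _ _ (Submodule.mul_mem_mul (lieFilt_mul_le k V _ _
    (Submodule.mul_mem_mul (ht a) (lieFilt_comm k V p q x y hx hy))) (ht b))
  rwa [zero_add, add_zero] at h1

theorem commFilt_le_lieFilt (n : ℕ) : commFilt k (TensorAlgebra k V) n ≤ lieFilt k V n := by
  induction n using Nat.strong_induction_on with
  | _ n ih =>
    rcases n with _ | n
    · rw [lieFilt_zero]; exact le_top
    · refine commFilt_succ_le k _ n _ (fun p hp hpn => ?_) (fun p hp => ?_)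
      · refine (mul_le_mul' (ih p (by omega)) (ih (n + 1 - p) (by omega))).trans ?_
        exact (lieFilt_mul_le k V _ _).trans (lieFilt_antitone k V (by omega))
      · refine (brIdeal_mono k _ (ih p (by omega)) (ih (n - p) (by omega))).trans ?_
        exact (brIdeal_lieFilt_le k V _ _).trans (lieFilt_antitone k V (by omega))

/-- the commutator filtration of the tensor algebra is
`F_n T V = Σ_r Σ_{d₁+⋯+d_r ≥ n} L_{d₁} V ⋯ L_{d_r} V`. -/
theorem commFilt_tensorAlgebra (n : ℕ) :
    commFilt k (TensorAlgebra k V) n =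
      ⨆ (l : List ℕ) (_ : n ≤ l.sum),
        (l.map fun d => freeLieGrade k V d).prod := by
  refine le_antisymm (commFilt_le_lieFilt k V n) (iSup₂_le fun l hl => ?_)
  exact (listProd_le_commFilt k V l).trans (commFilt_antitone k _ hl)
end

section
/- Let A be a commutative algebra over a field of characteristic zero with Poisson envelope P A = ⊕_{n≥0} P_n A (graded by bracket-degree), equipped with its Poisson commutator filtration F (F_0 = P A, F_{n+1} = Σ_{i=1}^{n} F_i F_{n+1-i} + Σ_{i=0}^{n} ⟨{F_i, F_{n-i}}⟩). Then F_r(P A) = P_{≥ r} A := ⊕_{n ≥ r} P_n A for every r ≥ 0. -/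
variable (k : Type) [Field k] [CharZero k]
variable (P : Type) [CommRing P] [Algebra k P]

variable (A : Type) [CommRing A] [Algebra k A]

/-- The bracket-degree-`d` piece of the Poisson envelope with structure map `η`:
`B 0 = η(A)`, `B (d+1) = span {η(A), B d}`. -/
def envGrade (pb : PoissonStructure k P) (η : A →ₐ[k] P) : ℕ → Submodule k P
  | 0 => LinearMap.range η.toLinearMap
  | d + 1 => Submodule.span k
      {z | ∃ x ∈ LinearMap.range η.toLinearMap, ∃ y ∈ envGrade pb η d,
        z = pb.bracket x y}

/-- The degree-`n` homogeneous component `P_n A` of the Poisson envelope: the span of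
products of bracket-degree pieces of total degree `n`. -/
def envHomog (pb : PoissonStructure k P) (η : A →ₐ[k] P) (n : ℕ) : Submodule k P :=
  ⨆ (l : List ℕ) (_ : l.sum = n), (l.map fun d => envGrade k P A pb η d).prod

section Helpers

set_option linter.unusedSectionVars false

variable {k P A}

theorem pb_skew (pb : PoissonStructure k P) (a b : P) :
    pb.bracket a b = - pb.bracket b a := by
  have h := pb.bracket_self (a + b)
  simp only [map_add, LinearMap.add_apply, pb.bracket_self, zero_add, add_zero] at h
  exact eq_neg_of_add_eq_zero_right h

theorem pb_leibniz_left (pb : PoissonStructure k P) (a b c : P) :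
    pb.bracket (a * b) c = pb.bracket a c * b + a * pb.bracket b c := by
  rw [pb_skew pb (a * b) c, pb.leibniz, pb_skew pb a c, pb_skew pb b c]
  ring

theorem pb_one (pb : PoissonStructure k P) (a : P) : pb.bracket a 1 = 0 := by
  have h := pb.leibniz a 1 1
  simpa using h

theorem grade_bracket (pb : PoissonStructure k P) (η : A →ₐ[k] P) (i : ℕ) :
    ∀ (j : ℕ) (x y : P), x ∈ envGrade k P A pb η i → y ∈ envGrade k P A pb η j →
      pb.bracket x y ∈ envGrade k P A pb η (i + j + 1) := by
  have h0 : ∀ (j : ℕ) (x y : P), x ∈ LinearMap.range η.toLinearMap →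
      y ∈ envGrade k P A pb η j → pb.bracket x y ∈ envGrade k P A pb η (j + 1) := by
    intro j x y hx hy
    exact Submodule.subset_span ⟨x, hx, y, hy, rfl⟩
  induction i with
  | zero =>
    intro j x y hx hy
    rw [zero_add]
    exact h0 j x y hx hy
  | succ i ih =>
    intro j x y hx hy
    rw [envGrade] at hx
    induction hx using Submodule.span_induction with
    | mem z hz =>
      obtain ⟨a, ha, b, hb, rfl⟩ := hz
      have e : pb.bracket (pb.bracket a b) y
          = pb.bracket a (pb.bracket b y) - pb.bracket b (pb.bracket a y) := by
        rw [pb.jacobi a b y]; ring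
      rw [e]
      apply Submodule.sub_mem
      · have := h0 _ _ _ ha (ih j b y hb hy)
        rwa [show i + 1 + j + 1 = i + j + 1 + 1 by omega]
      · have := ih (j + 1) b _ hb (h0 _ _ _ ha hy)
        rwa [show i + 1 + j + 1 = i + (j + 1) + 1 by omega]
    | zero => simp
    | add a b _ _ ha hb => rw [map_add, LinearMap.add_apply]; exact Submodule.add_mem _ ha hb
    | smul c a _ ha => rw [map_smul, LinearMap.smul_apply]; exact Submodule.smul_mem _ _ ha

theorem list_le_homog (pb : PoissonStructure k P) (η : A →ₐ[k] P) (l : List ℕ) :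
    (l.map fun d => envGrade k P A pb η d).prod ≤ envHomog k P A pb η l.sum :=
  le_iSup₂_of_le l rfl le_rfl

theorem grade_le_homog (pb : PoissonStructure k P) (η : A →ₐ[k] P) (d : ℕ) :
    envGrade k P A pb η d ≤ envHomog k P A pb η d := by
  simpa using list_le_homog pb η [d]

theorem homog_mul (pb : PoissonStructure k P) (η : A →ₐ[k] P) (m n : ℕ) :
    envHomog k P A pb η m * envHomog k P A pb η n ≤ envHomog k P A pb η (m + n) := by
  conv_lhs => rw [envHomog, envHomog]
  simp only [Submodule.iSup_mul, Submodule.mul_iSup]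
  refine iSup₂_le fun l hl => iSup₂_le fun l' hl' => ?_
  have := list_le_homog pb η (l ++ l')
  have := list_le_homog pb η (l' ++ l)
  simp_all [add_comm]

theorem homog_ind (pb : PoissonStructure k P) (η : A →ₐ[k] P) (K : ℕ → Submodule k P)
    (h1 : (1 : P) ∈ K 0)
    (hc : ∀ d n x y, x ∈ envGrade k P A pb η d → y ∈ envHomog k P A pb η n → y ∈ K n →
      x * y ∈ K (d + n)) (n : ℕ) : envHomog k P A pb η n ≤ K n := by
  refine iSup₂_le fun l hl => ?_
  subst hl
  induction l with
  | nil =>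
    simpa [Submodule.one_le] using h1
  | cons d l ih =>
    rw [List.map_cons, List.prod_cons, List.sum_cons, Submodule.mul_le]
    intro x hx y hy
    exact hc _ _ _ _ hx (list_le_homog pb η l hy) (ih hy)

theorem homog_bracket (pb : PoissonStructure k P) (η : A →ₐ[k] P) (m n : ℕ) (x y : P)
    (hx : x ∈ envHomog k P A pb η m) (hy : y ∈ envHomog k P A pb η n) :
    pb.bracket x y ∈ envHomog k P A pb η (m + n + 1) := by
  have key : ∀ (i : ℕ) (x : P), x ∈ envGrade k P A pb η i → ∀ (n : ℕ) (y : P),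
      y ∈ envHomog k P A pb η n → pb.bracket x y ∈ envHomog k P A pb η (i + n + 1) := by
    intro i x hx n
    refine homog_ind pb η
      (fun n => (envHomog k P A pb η (i + n + 1)).comap (pb.bracket x)) ?_ ?_ n
    · simp [pb_one]
    · intro d n u v hu hv hv'
      rw [Submodule.mem_comap] at hv' ⊢
      rw [pb.leibniz]
      apply Submodule.add_mem
      · rw [show i + (d + n) + 1 = (i + d + 1) + n by omega]
        exact homog_mul pb η _ _ (Submodule.mul_mem_mul
          (grade_le_homog pb η _ (grade_bracket pb η i d x u hx hu)) hv)
      · rw [show i + (d + n) + 1 = d + (i + n + 1) by omega]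
        exact homog_mul pb η _ _ (Submodule.mul_mem_mul (grade_le_homog pb η _ hu) hv')
  have := homog_ind pb η
      (fun m => (envHomog k P A pb η (m + n + 1)).comap (pb.bracket.flip y)) ?_ ?_ m hx
  · exact this
  · rw [Submodule.mem_comap, LinearMap.flip_apply, pb_skew, pb_one]; simp
  · intro d m u v hu hv hv'
    rw [Submodule.mem_comap, LinearMap.flip_apply] at hv' ⊢
    rw [pb_leibniz_left]
    apply Submodule.add_mem
    · rw [show d + m + n + 1 = (d + n + 1) + m by omega]
      exact homog_mul pb η _ _ (Submodule.mul_mem_mul (key _ _ hu _ _ hy) hv)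
    · rw [show d + m + n + 1 = d + (m + n + 1) by omega]
      exact homog_mul pb η _ _ (Submodule.mul_mem_mul (grade_le_homog pb η _ hu) hv')

/-- The degree filtration. -/
def degFilt (pb : PoissonStructure k P) (η : A →ₐ[k] P) (r : ℕ) : Submodule k P :=
  ⨆ (n : ℕ) (_ : r ≤ n), envHomog k P A pb η n

theorem homog_le_deg (pb : PoissonStructure k P) (η : A →ₐ[k] P) {r n : ℕ} (h : r ≤ n) :
    envHomog k P A pb η n ≤ degFilt pb η r := le_iSup₂_of_le n h le_rfl

theorem deg_mul (pb : PoissonStructure k P) (η : A →ₐ[k] P) (m n : ℕ) :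
    degFilt pb η m * degFilt pb η n ≤ degFilt pb η (m + n) := by
  conv_lhs => rw [degFilt, degFilt]
  simp only [Submodule.iSup_mul, Submodule.mul_iSup]
  refine iSup₂_le fun a ha => iSup₂_le fun b hb => ?_
  first
  | exact (homog_mul pb η _ _).trans (homog_le_deg pb η (by omega))

theorem deg_bracket (pb : PoissonStructure k P) (η : A →ₐ[k] P) (m n : ℕ) (x y : P)
    (hx : x ∈ degFilt pb η m) (hy : y ∈ degFilt pb η n) :
    pb.bracket x y ∈ degFilt pb η (m + n + 1) := by
  have h2 : ∀ a, m ≤ a → ∀ x ∈ envHomog k P A pb η a,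
      degFilt pb η n ≤ (degFilt pb η (m + n + 1)).comap (pb.bracket x) := by
    intro a ha x hx
    refine iSup₂_le fun b hb => ?_
    intro y hy
    exact homog_le_deg pb η (by omega) (homog_bracket pb η a b x y hx hy)
  have h1 : degFilt pb η m ≤ (degFilt pb η (m + n + 1)).comap (pb.bracket.flip y) := by
    refine iSup₂_le fun a ha => ?_
    intro x hx
    exact h2 a ha x hx hy
  exact h1 hx

theorem deg_zero_one (pb : PoissonStructure k P) (η : A →ₐ[k] P) :
    (1 : P) ∈ degFilt pb η 0 :=
  homog_le_deg pb η le_rfl (grade_le_homog pb η 0 ⟨1, by simp⟩)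

/-- The Poisson subalgebra generated by the image of `η`. -/
def genSub (pb : PoissonStructure k P) (η : A →ₐ[k] P) : Subalgebra k P :=
  (degFilt pb η 0).toSubalgebra (deg_zero_one pb η)
    (fun _ _ hx hy => deg_mul pb η 0 0 (Submodule.mul_mem_mul hx hy))

theorem mem_genSub (pb : PoissonStructure k P) (η : A →ₐ[k] P) (x : P) :
    x ∈ genSub pb η ↔ x ∈ degFilt pb η 0 := Iff.rfl

theorem genSub_bracket (pb : PoissonStructure k P) (η : A →ₐ[k] P) (x y : genSub pb η) :
    pb.bracket x y ∈ genSub pb η := by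
  have := deg_bracket pb η 0 0 x y x.2 y.2
  rw [mem_genSub]
  exact (iSup₂_le fun n _ => homog_le_deg pb η (Nat.zero_le n) :
    degFilt pb η (0 + 0 + 1) ≤ degFilt pb η 0) this

/-- The restricted Poisson structure. -/
def genPb (pb : PoissonStructure k P) (η : A →ₐ[k] P) : PoissonStructure k (genSub pb η) where
  bracket := LinearMap.mk₂ k (fun x y => ⟨pb.bracket x y, genSub_bracket pb η x y⟩)
    (by intros; ext; simp) (by intros; ext; simp) (by intros; ext; simp) (by intros; ext; simp)
  bracket_self a := by ext; simp [pb.bracket_self]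
  jacobi a b c := by ext; simpa using pb.jacobi a b c
  leibniz a b c := by ext; simpa using pb.leibniz a b c

theorem deg_zero_top (pb : PoissonStructure k P) (η : A →ₐ[k] P)
    (hP : ∀ (Q : Type) [CommRing Q] [Algebra k Q] (qb : PoissonStructure k Q)
        (f : A →ₐ[k] Q),
      ∃! g : P →ₐ[k] Q,
        (∀ x y : P, g (pb.bracket x y) = qb.bracket (g x) (g y)) ∧ g.comp η = f) :
    degFilt pb η 0 = ⊤ := by
  have hη : ∀ a, η a ∈ genSub pb η := fun a =>
    homog_le_deg pb η le_rfl (grade_le_homog pb η 0 ⟨a, rfl⟩)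
  obtain ⟨g, ⟨hg, hgη⟩, -⟩ := hP (genSub pb η) (genPb pb η) (η.codRestrict _ hη)
  have hu := (hP P pb η).unique (y₁ := (genSub pb η).val.comp g) (y₂ := AlgHom.id k P)
    ⟨fun x y => by
      simp only [AlgHom.comp_apply, hg]
      rfl, by rw [AlgHom.comp_assoc, hgη]; rfl⟩
    ⟨fun x y => rfl, rfl⟩
  rw [eq_top_iff]
  intro x _
  have := DFunLike.congr_fun hu x
  simp only [AlgHom.comp_apply, AlgHom.id_apply] at this
  rw [← this]
  exact (g x).2

theorem filt_le (pb : PoissonStructure k P) (n : ℕ) (K : Submodule k P)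
    (h1 : ∀ i, 1 ≤ i → i ≤ n → ∀ x ∈ poissonFilt k P pb i,
      ∀ y ∈ poissonFilt k P pb (n + 1 - i), x * y ∈ K)
    (h2 : ∀ i, i ≤ n → ∀ a, ∀ x ∈ poissonFilt k P pb i,
      ∀ y ∈ poissonFilt k P pb (n - i), a * pb.bracket x y ∈ K) :
    poissonFilt k P pb (n + 1) ≤ K := by
  rw [poissonFilt, Submodule.add_eq_sup]
  refine sup_le ?_ ?_
  · refine Finset.sum_induction _ (· ≤ K) (fun a b ha hb => sup_le ha hb) bot_le ?_
    rintro ⟨i, hi⟩ -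
    have := Finset.mem_Icc.mp hi
    exact Submodule.mul_le.2 (h1 i this.1 this.2)
  · refine Finset.sum_induction _ (· ≤ K) (fun a b ha hb => sup_le ha hb) bot_le ?_
    rintro ⟨i, hi⟩ -
    have := Finset.mem_range.mp hi
    refine Submodule.span_le.2 ?_
    rintro _ ⟨a, _, ⟨x, hx, y, hy, rfl⟩, rfl⟩
    exact h2 i (by omega) a x hx y hy

theorem filt_mul_mem (pb : PoissonStructure k P) (n i : ℕ) (h1 : 1 ≤ i) (h2 : i ≤ n) (x y : P)
    (hx : x ∈ poissonFilt k P pb i) (hy : y ∈ poissonFilt k P pb (n + 1 - i)) :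
    x * y ∈ poissonFilt k P pb (n + 1) := by
  rw [poissonFilt, Submodule.add_eq_sup]
  refine Submodule.mem_sup_left ?_
  exact Finset.single_le_sum (N := Submodule k P)
    (f := fun p : {p // p ∈ Finset.Icc 1 n} =>
      poissonFilt k P pb p.1 * poissonFilt k P pb (n + 1 - p.1))
    (fun _ _ => bot_le) (Finset.mem_attach _ ⟨i, Finset.mem_Icc.2 ⟨h1, h2⟩⟩)
    (Submodule.mul_mem_mul hx hy)

theorem filt_br_mem (pb : PoissonStructure k P) (n i : ℕ) (h2 : i ≤ n) (a x y : P)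
    (hx : x ∈ poissonFilt k P pb i) (hy : y ∈ poissonFilt k P pb (n - i)) :
    a * pb.bracket x y ∈ poissonFilt k P pb (n + 1) := by
  rw [poissonFilt, Submodule.add_eq_sup]
  refine Submodule.mem_sup_right ?_
  exact Finset.single_le_sum (N := Submodule k P)
    (f := fun p : {p // p ∈ Finset.range (n + 1)} =>
      pBrIdeal k P pb (poissonFilt k P pb p.1) (poissonFilt k P pb (n - p.1)))
    (fun _ _ => bot_le) (Finset.mem_attach _ ⟨i, Finset.mem_range.2 (by omega)⟩)
    (Submodule.subset_span ⟨a, _, ⟨x, hx, y, hy, rfl⟩, rfl⟩)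

theorem filt_zero_mem (pb : PoissonStructure k P) (x : P) : x ∈ poissonFilt k P pb 0 := by
  rw [poissonFilt]; trivial

theorem filt_ideal (pb : PoissonStructure k P) (n : ℕ) :
    ∀ a x, x ∈ poissonFilt k P pb n → a * x ∈ poissonFilt k P pb n := by
  induction n using Nat.strong_induction_on with
  | _ n ih =>
  cases n with
  | zero => intro a x _; exact filt_zero_mem pb _
  | succ n =>
    intro a
    refine filt_le pb n ((poissonFilt k P pb (n + 1)).comap (LinearMap.mulLeft k a)) ?_ ?_
    · intro i h1 h2 x hx y hy
      rw [Submodule.mem_comap, LinearMap.mulLeft_apply, ← mul_assoc]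
      exact filt_mul_mem pb n i h1 h2 _ _ (ih i (by omega) a x hx) hy
    · intro i h2 b x hx y hy
      rw [Submodule.mem_comap, LinearMap.mulLeft_apply, ← mul_assoc]
      exact filt_br_mem pb n i h2 _ _ _ hx hy

theorem filt_mul (pb : PoissonStructure k P) (m n : ℕ) (x y : P)
    (hx : x ∈ poissonFilt k P pb m) (hy : y ∈ poissonFilt k P pb n) :
    x * y ∈ poissonFilt k P pb (m + n) := by
  rcases Nat.eq_zero_or_pos m with rfl | hm
  · rw [zero_add]; exact filt_ideal pb n x y hy
  rcases Nat.eq_zero_or_pos n with rfl | hn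
  · rw [mul_comm]; exact filt_ideal pb m y x hx
  obtain ⟨n, rfl⟩ : ∃ q, n = q + 1 := ⟨n - 1, by omega⟩
  exact filt_mul_mem pb (m + n) m hm (by omega) x y hx
    (by rwa [show m + n + 1 - m = n + 1 by omega])

theorem filt_succ_le (pb : PoissonStructure k P) (n : ℕ) :
    poissonFilt k P pb (n + 1) ≤ poissonFilt k P pb n := by
  induction n using Nat.strong_induction_on with
  | _ n ih =>
  cases n with
  | zero => intro x _; exact filt_zero_mem pb x
  | succ n =>
    refine filt_le pb (n + 1) _ ?_ ?_
    · intro i h1 h2 x hx y hy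
      obtain ⟨i, rfl⟩ : ∃ q, i = q + 1 := ⟨i - 1, by omega⟩
      have hx' := ih i (by omega) hx
      have := filt_mul pb _ _ x y hx' hy
      rwa [show i + (n + 1 + 1 - (i + 1)) = n + 1 by omega] at this
    · intro i h2 a x hx y hy
      cases i with
      | zero => exact filt_br_mem pb n 0 (by omega) a x y hx (ih n (by omega) hy)
      | succ i =>
        refine filt_br_mem pb n i (by omega) a x y (ih i (by omega) hx) ?_
        rwa [show n + 1 - (i + 1) = n - i by omega] at hy

theorem grade_le_filt (pb : PoissonStructure k P) (η : A →ₐ[k] P) (d : ℕ) :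
    envGrade k P A pb η d ≤ poissonFilt k P pb d := by
  induction d with
  | zero => intro x _; exact filt_zero_mem pb x
  | succ d ih =>
    rw [envGrade, Submodule.span_le]
    rintro _ ⟨x, -, y, hy, rfl⟩
    have := filt_br_mem pb d 0 (Nat.zero_le _) 1 x y (filt_zero_mem pb x) (ih hy)
    rwa [one_mul] at this

theorem homog_le_filt (pb : PoissonStructure k P) (η : A →ₐ[k] P) (n : ℕ) :
    envHomog k P A pb η n ≤ poissonFilt k P pb n :=
  homog_ind pb η (poissonFilt k P pb) (filt_zero_mem pb 1)
    (fun d n x y hx _ hy => filt_mul pb d n x y (grade_le_filt pb η d hx) hy) n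

end Helpers

/-- for the Poisson envelope `η : A → P` of a commutative algebra `A`
(witnessed by its universal property), the Poisson commutator filtration coincides
with the filtration by degree: `F_r P A = P_{≥ r} A = ⊕_{n ≥ r} P_n A`. -/
theorem poissonFilt_envelope_eq_degree_filtration
    (pb : PoissonStructure k P) (η : A →ₐ[k] P)
    (hP : ∀ (Q : Type) [CommRing Q] [Algebra k Q] (qb : PoissonStructure k Q)
        (f : A →ₐ[k] Q),
      ∃! g : P →ₐ[k] Q,
        (∀ x y : P, g (pb.bracket x y) = qb.bracket (g x) (g y)) ∧ g.comp η = f)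
    (r : ℕ) :
    poissonFilt k P pb r = ⨆ (n : ℕ) (_ : r ≤ n), envHomog k P A pb η n := by
  change _ = degFilt pb η r
  have htop := deg_zero_top pb η hP
  apply le_antisymm
  · induction r using Nat.strong_induction_on with
    | _ r ih =>
    cases r with
    | zero => rw [htop]; exact le_top
    | succ n =>
      refine filt_le pb n _ ?_ ?_
      · intro i h1 h2 x hx y hy
        have := deg_mul pb η _ _ (Submodule.mul_mem_mul (ih i (by omega) hx)
          (ih (n + 1 - i) (by omega) hy))
        rwa [show i + (n + 1 - i) = n + 1 by omega] at this
      · intro i h2 a x hx y hy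
        have h := deg_bracket pb η _ _ x y (ih i (by omega) hx) (ih (n - i) (by omega) hy)
        rw [show i + (n - i) + 1 = n + 1 by omega] at h
        have ha : a ∈ degFilt pb η 0 := by rw [htop]; trivial
        have := deg_mul pb η _ _ (Submodule.mul_mem_mul ha h)
        rwa [zero_add] at this
  · refine iSup₂_le fun n hn => ?_
    exact (homog_le_filt pb η n).trans (antitone_nat_of_succ_le (filt_succ_le pb) hn)
end
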